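/- Let t ∈ ℝ, 0 ≤ β ≤ 1, and let r > 0 satisfy r·β·e^r < 1. Then for every real z with |z| ≤ r, one has 1 + β(e^z − 1) > 0 and (1 + β(e^z − 1))^{−t} = Σ_{n=0}^∞ (z^n/n!) · Σ_{m=0}^n C(−t,m)·β^m·m!·S(n,m), the series converging absolutely, where S(n,m) is the Stirling number of the second kind and for real s, C(s,m) = s(s−1)⋯(s−m+1)/m!. -/

import Mathlib

open Real Finset

/-- Generalized binomial coefficient `C(s, m) = s(s-1)⋯(s-m+1)/m!` for real `s`. -/
noncomputable def genBinom (s : ℝ) (m : ℕ) : ℝ :=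
  (∏ i ∈ Finset.range m, (s - (i : ℝ))) / (Nat.factorial m : ℝ)

/-- Stirling numbers of the second kind (as real numbers):
`S(n,m) = (1/m!) ∑_{k=0}^m C(m,k) (−1)^{m−k} k^n`. -/
noncomputable def stirling2 (n m : ℕ) : ℝ :=
  (1 / (Nat.factorial m : ℝ)) *
    ∑ k ∈ Finset.range (m + 1),
      (Nat.choose m k : ℝ) * (-1 : ℝ) ^ (m - k) * (k : ℝ) ^ n

theorem stirling2_zero_succ (m : ℕ) : stirling2 0 (m + 1) = 0 := by
  have h := add_pow (1 : ℝ) (-1) (m + 1)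
  simp only [add_neg_cancel, ne_eq, Nat.add_eq_zero_iff, one_ne_zero, and_false,
    not_false_eq_true, zero_pow, one_pow, one_mul] at h
  have h' : ∑ k ∈ range (m + 1 + 1),
      ((m + 1).choose k : ℝ) * (-1 : ℝ) ^ (m + 1 - k) * (k : ℝ) ^ 0 = 0 := by
    rw [h]
    exact sum_congr rfl fun k _ => by ring
  rw [stirling2, h', mul_zero]

theorem stirling2_succ_succ (n m : ℕ) :
    stirling2 (n + 1) (m + 1) = (m + 1) * stirling2 n (m + 1) + stirling2 n m := by
  have key : ∑ k ∈ range (m + 1 + 1),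
        ((m + 1).choose k : ℝ) * (-1 : ℝ) ^ (m + 1 - k) * (k : ℝ) ^ (n + 1) =
      (m + 1) * (∑ k ∈ range (m + 1 + 1),
          ((m + 1).choose k : ℝ) * (-1 : ℝ) ^ (m + 1 - k) * (k : ℝ) ^ n +
        ∑ k ∈ range (m + 1), (m.choose k : ℝ) * (-1 : ℝ) ^ (m - k) * (k : ℝ) ^ n) := by
    rw [sum_range_succ, sum_range_succ _ (m + 1), add_right_comm, ← sum_add_distrib, mul_add,
      mul_sum]
    congr 1
    · refine sum_congr rfl fun k hk => ?_
      have hkm : k ≤ m := Nat.lt_succ_iff.mp (mem_range.mp hk)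
      have hc : (m.choose k : ℝ) * (m + 1) = (m + 1).choose k * (m + 1 - k) := by
        have := Nat.choose_mul_succ_eq m k
        rw [← Nat.cast_inj (R := ℝ)] at this
        push_cast [Nat.cast_sub (hkm.trans m.le_succ)] at this
        exact this
      rw [Nat.succ_sub hkm, pow_succ, pow_succ]
      linear_combination (-(-1 : ℝ) ^ (m - k) * (k : ℝ) ^ n) * hc
    · push_cast
      ring
  have hm : (m.factorial : ℝ) ≠ 0 := by positivity
  simp only [stirling2, key, Nat.factorial_succ]
  push_cast
  field_simp

theorem stirling2_eq_stirlingSecond (n m : ℕ) : stirling2 n m = Nat.stirlingSecond n m := by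
  induction n generalizing m with
  | zero =>
    cases m with
    | zero => simp [stirling2]
    | succ m => simp [stirling2_zero_succ]
  | succ n ih =>
    cases m with
    | zero => simp [stirling2]
    | succ m =>
      rw [stirling2_succ_succ, ih, ih, Nat.stirlingSecond_succ_succ]
      push_cast
      rfl

theorem hasSum_stirling2_mul_pow_div_factorial (m : ℕ) (x : ℝ) :
    HasSum (fun n : ℕ => x ^ n / (n.factorial : ℝ) * ((m.factorial : ℝ) * stirling2 n m))
      ((exp x - 1) ^ m) := by
  have hexp (k : ℕ) : HasSum (fun n : ℕ => ((k : ℝ) * x) ^ n / (n.factorial : ℝ))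
      (exp x ^ k) := by
    rw [← Real.exp_nat_mul, Real.exp_eq_exp_ℝ]
    exact NormedSpace.expSeries_div_hasSum_exp _
  have hsum := hasSum_sum fun k (_ : k ∈ range (m + 1)) =>
    (hexp k).mul_left ((m.choose k : ℝ) * (-1 : ℝ) ^ (m - k))
  convert! hsum using 1
  · funext n
    have hm : (m.factorial : ℝ) ≠ 0 := by positivity
    rw [stirling2, ← mul_assoc (m.factorial : ℝ), mul_one_div_cancel hm, one_mul, mul_sum]
    exact sum_congr rfl fun k _ => by rw [mul_pow]; ring
  · rw [sub_eq_add_neg, add_pow]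
    exact sum_congr rfl fun k _ => by ring

theorem genBinom_eq_choose (s : ℝ) (m : ℕ) : genBinom s m = Ring.choose s m := by
  rw [Ring.choose_eq_smul, genBinom, ← descPochhammer_eval_eq_prod_range,
    Polynomial.eval_eq_smeval, ← descPochhammer_map (Int.castRingHom ℝ), div_eq_inv_mul,
    smul_eq_mul, ← Polynomial.eval_eq_smeval, Polynomial.eval_map,
    ← Polynomial.eval₂_smulOneHom_eq_smeval]
  congr 2
  exact Subsingleton.elim _ _

theorem binomialSeries_apply_const (s x : ℝ) (m : ℕ) :
    (binomialSeries ℝ s m fun _ => x) = genBinom s m * x ^ m := by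
  rw [binomialSeries_apply, genBinom_eq_choose, List.ofFn_const, List.prod_replicate,
    smul_eq_mul]

theorem hasSum_genBinom_mul_pow (s : ℝ) {x : ℝ} (hx : |x| < 1) :
    HasSum (fun m => genBinom s m * x ^ m) ((1 + x) ^ s) := by
  have hmem : x ∈ Metric.eball (0 : ℝ) 1 := by
    rw [← ENNReal.ofReal_one, Metric.eball_ofReal, mem_ball_zero_iff]
    exact hx
  have h := one_add_rpow_hasFPowerSeriesOnBall_zero (a := s).hasSum hmem
  simpa only [binomialSeries_apply_const, zero_add] using h

theorem summable_abs_genBinom_mul_pow (s : ℝ) {x : ℝ} (hx0 : 0 ≤ x) (hx : x < 1) :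
    Summable fun m => |genBinom s m| * x ^ m := by
  have h := (hasSum_genBinom_mul_pow s ((abs_of_nonneg hx0).trans_lt hx)).summable.abs
  simpa only [abs_mul, abs_of_nonneg (pow_nonneg hx0 _)] using h

theorem abs_exp_sub_one_le_exp_abs_sub_one (z : ℝ) : |exp z - 1| ≤ exp |z| - 1 := by
  rcases le_total 0 z with h | h
  · rw [abs_of_nonneg h, abs_of_nonneg (sub_nonneg.mpr (one_le_exp h))]
  · rw [abs_of_nonpos h, abs_of_nonpos (sub_nonpos.mpr (exp_le_one_iff.mpr h))]
    have h₁ := add_one_le_exp z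
    have h₂ := add_one_le_exp (-z)
    linarith

theorem exp_sub_one_le_mul_exp (x : ℝ) : exp x - 1 ≤ x * exp x := by
  have h := mul_le_mul_of_nonneg_right (add_one_le_exp (-x)) (exp_pos x).le
  rw [← exp_add, neg_add_cancel, exp_zero] at h
  linarith

theorem summable_genBinom_mul_stirling2 (s : ℝ) {β z : ℝ} (hβ : 0 ≤ β)
    (h : β * (exp |z| - 1) < 1) :
    Summable fun p : ℕ × ℕ => genBinom s p.1 * β ^ p.1 *
      (z ^ p.2 / (p.2.factorial : ℝ) * ((p.1.factorial : ℝ) * stirling2 p.2 p.1)) := by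
  have hS (n m : ℕ) : 0 ≤ stirling2 n m := by
    rw [stirling2_eq_stirlingSecond]
    positivity
  have habs (m n : ℕ) : |genBinom s m * β ^ m *
        (z ^ n / (n.factorial : ℝ) * ((m.factorial : ℝ) * stirling2 n m))| =
      |genBinom s m| * β ^ m *
        (|z| ^ n / (n.factorial : ℝ) * ((m.factorial : ℝ) * stirling2 n m)) := by
    simp [abs_mul, abs_div, abs_pow, abs_of_nonneg hβ, abs_of_nonneg (hS _ _)]
  rw [← summable_abs_iff, summable_prod_of_nonneg fun p => abs_nonneg _]
  simp only [habs]
  have hrow (m : ℕ) := (hasSum_stirling2_mul_pow_div_factorial m |z|).mul_left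
    (|genBinom s m| * β ^ m)
  refine ⟨fun m => (hrow m).summable, ?_⟩
  simp only [fun m => (hrow m).tsum_eq]
  simp only [mul_assoc, ← mul_pow]
  exact summable_abs_genBinom_mul_pow s
    (mul_nonneg hβ (sub_nonneg.mpr (one_le_exp (abs_nonneg z)))) h

theorem hasSum_rpow_one_add_mul_exp_sub_one (s : ℝ) {β z : ℝ} (hβ : 0 ≤ β)
    (h : β * (exp |z| - 1) < 1) :
    HasSum (fun n : ℕ => z ^ n / (n.factorial : ℝ) * ∑ m ∈ range (n + 1),
      genBinom s m * β ^ m * (m.factorial : ℝ) * stirling2 n m)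
      ((1 + β * (exp z - 1)) ^ s) := by
  have hsum := summable_genBinom_mul_stirling2 s hβ h
  have hx : |β * (exp z - 1)| < 1 := by
    rw [abs_mul, abs_of_nonneg hβ]
    exact (mul_le_mul_of_nonneg_left (abs_exp_sub_one_le_exp_abs_sub_one z) hβ).trans_lt h
  have hcol (n : ℕ) : HasSum (fun m : ℕ => genBinom s m * β ^ m *
        (z ^ n / (n.factorial : ℝ) * ((m.factorial : ℝ) * stirling2 n m)))
      (z ^ n / (n.factorial : ℝ) * ∑ m ∈ range (n + 1),
        genBinom s m * β ^ m * (m.factorial : ℝ) * stirling2 n m) := by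
    have hfin : z ^ n / (n.factorial : ℝ) * ∑ m ∈ range (n + 1),
          genBinom s m * β ^ m * (m.factorial : ℝ) * stirling2 n m =
        ∑ m ∈ range (n + 1), genBinom s m * β ^ m *
          (z ^ n / (n.factorial : ℝ) * ((m.factorial : ℝ) * stirling2 n m)) := by
      rw [mul_sum]
      exact sum_congr rfl fun m _ => by ring
    rw [hfin]
    refine hasSum_sum_of_ne_finset_zero fun m hm => ?_
    rw [stirling2_eq_stirlingSecond, Nat.stirlingSecond_eq_zero_of_lt
      (Nat.lt_of_succ_le (not_lt.mp (mem_range.not.mp hm)))]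
    simp
  have hrow (m : ℕ) : HasSum (fun n : ℕ => genBinom s m * β ^ m *
        (z ^ n / (n.factorial : ℝ) * ((m.factorial : ℝ) * stirling2 n m)))
      (genBinom s m * (β * (exp z - 1)) ^ m) := by
    rw [mul_pow, ← mul_assoc]
    exact (hasSum_stirling2_mul_pow_div_factorial m z).mul_left _
  rw [(hasSum_genBinom_mul_pow s hx).unique (hsum.hasSum.prod_fiberwise hrow)]
  exact ((Equiv.prodComm ℕ ℕ).hasSum_iff.mpr hsum.hasSum).prod_fiberwise hcol

theorem stmt_15 (t β : ℝ) (hβ0 : 0 ≤ β) (hβ1 : β ≤ 1)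
    (r : ℝ) (hr : 0 < r) (hcond : r * β * Real.exp r < 1)
    (z : ℝ) (hz : |z| ≤ r) :
    0 < 1 + β * (Real.exp z - 1) ∧
    Summable (fun n : ℕ => |z ^ n / (Nat.factorial n : ℝ) *
      ∑ m ∈ Finset.range (n + 1),
        genBinom (-t) m * β ^ m * (Nat.factorial m : ℝ) * stirling2 n m|) ∧
    (1 + β * (Real.exp z - 1)) ^ (-t) =
      ∑' n : ℕ, z ^ n / (Nat.factorial n : ℝ) *
        ∑ m ∈ Finset.range (n + 1),
          genBinom (-t) m * β ^ m * (Nat.factorial m : ℝ) * stirling2 n m := by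
  have hexp : β * (exp |z| - 1) < 1 := by
    refine lt_of_le_of_lt ?_ hcond
    have h := (sub_le_sub_right (exp_le_exp.mpr hz) 1).trans (exp_sub_one_le_mul_exp r)
    calc β * (exp |z| - 1) ≤ β * (r * exp r) := mul_le_mul_of_nonneg_left h hβ0
      _ = r * β * exp r := by ring
  have hsum := hasSum_rpow_one_add_mul_exp_sub_one (-t) hβ0 hexp
  refine ⟨?_, hsum.summable.abs, hsum.tsum_eq.symm⟩
  have h := mul_le_mul_of_nonneg_left
    ((neg_le_abs _).trans (abs_exp_sub_one_le_exp_abs_sub_one z)) hβ0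
  linarith
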